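/- Let Ω be a nonempty bounded open subset of ℝ⁴ with Lebesgue measure |Ω|, let λ₁, λ₂ ∈ ℝ, μ₁, μ₂ > 0, θ₁, θ₂ < 0, and suppose u, v ∈ C_c^∞(Ω) satisfy ℒ'(u,v)(u,v) = 0. Then: (a) if β > 0, then ℒ(u,v) ≥ −(θ₁²/(4μ₁) + θ₂²/(4μ₂))·|Ω|; (b) if −√(μ₁μ₂) < β < 0, then ℒ(u,v) ≥ −(θ₁²/(4(μ₁+β√(μ₁/μ₂))) + θ₂²/(4(μ₂+β√(μ₂/μ₁))))·|Ω|; (c) for any β ∈ ℝ, if 2·min{θ₁, θ₂} ≥ −λ₁(Ω), then ℒ(u,v) ≥ ((θ₁/4)e^{−λ₁/θ₁−1} + (θ₂/4)e^{−λ₂/θ₂−1})·|Ω|. In each case the infimum of ℒ over all such pairs is finite. -/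

import Mathlib

open MeasureTheory

noncomputable section

/-- The space `ℝ⁴`, with its Lebesgue measure. -/
abbrev E4 : Type := EuclideanSpace ℝ (Fin 4)

/-- `C_c^∞(Ω)`: smooth real-valued functions with compact support contained in `Ω`,
extended by zero to `ℝ⁴`. -/
def TestFun (Ω : Set E4) (u : E4 → ℝ) : Prop :=
  ContDiff ℝ (⊤ : ℕ∞) u ∧ HasCompactSupport u ∧ tsupport u ⊆ Ω

/-- The positive part `u⁺ = max{u, 0}`. -/
def pp (u : E4 → ℝ) (x : E4) : ℝ := max (u x) 0

/-- The squared norm `|∇u|²` of the gradient. -/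
def gradSq (u : E4 → ℝ) (x : E4) : ℝ := ‖fderiv ℝ u x‖ ^ 2

/-- The best Sobolev constant `S` of the embedding `D^{1,2}(ℝ⁴) ↪ L⁴(ℝ⁴)`. -/
def sobolevS : ℝ :=
  sInf { r : ℝ | ∃ w : E4 → ℝ, ContDiff ℝ (⊤ : ℕ∞) w ∧ HasCompactSupport w ∧ w ≠ 0 ∧
    r = (∫ x, gradSq w x) / (∫ x, (w x) ^ 4) ^ ((1 : ℝ) / 2) }

/-- The first Dirichlet eigenvalue `λ₁(Ω)` of `−Δ` on `Ω`, as the infimum of the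
Rayleigh quotient over test functions. -/
def lamOne (Ω : Set E4) : ℝ :=
  sInf { r : ℝ | ∃ w : E4 → ℝ, TestFun Ω w ∧ w ≠ 0 ∧
    r = (∫ x in Ω, gradSq w x) / (∫ x in Ω, (w x) ^ 2) }

/-- The modified energy functional `ℒ(u,v)` of the system. -/
def LL (Ω : Set E4) (lam1 mu1 th1 lam2 mu2 th2 β : ℝ) (u v : E4 → ℝ) : ℝ :=
  (1 / 2) * (∫ x in Ω, gradSq u x) - (lam1 / 2) * (∫ x in Ω, (pp u x) ^ 2)
    - (mu1 / 4) * (∫ x in Ω, (pp u x) ^ 4)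
    - (th1 / 2) * (∫ x in Ω, (pp u x) ^ 2 * (Real.log ((pp u x) ^ 2) - 1))
    + (1 / 2) * (∫ x in Ω, gradSq v x) - (lam2 / 2) * (∫ x in Ω, (pp v x) ^ 2)
    - (mu2 / 4) * (∫ x in Ω, (pp v x) ^ 4)
    - (th2 / 2) * (∫ x in Ω, (pp v x) ^ 2 * (Real.log ((pp v x) ^ 2) - 1))
    - (β / 2) * (∫ x in Ω, (pp u x) ^ 2 * (pp v x) ^ 2)

/-- The pairing `ℒ'(u,v)(u,v)` of the derivative of the energy with `(u,v)`. -/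
def LLp (Ω : Set E4) (lam1 mu1 th1 lam2 mu2 th2 β : ℝ) (u v : E4 → ℝ) : ℝ :=
  (∫ x in Ω, gradSq u x) + (∫ x in Ω, gradSq v x)
    - lam1 * (∫ x in Ω, (pp u x) ^ 2) - lam2 * (∫ x in Ω, (pp v x) ^ 2)
    - mu1 * (∫ x in Ω, (pp u x) ^ 4) - mu2 * (∫ x in Ω, (pp v x) ^ 4)
    - 2 * β * (∫ x in Ω, (pp u x) ^ 2 * (pp v x) ^ 2)
    - th1 * (∫ x in Ω, (pp u x) ^ 2 * Real.log ((pp u x) ^ 2))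
    - th2 * (∫ x in Ω, (pp v x) ^ 2 * Real.log ((pp v x) ^ 2))

lemma aux_int {Ω : Set E4} {u : E4 → ℝ} (hu : TestFun Ω u) (g : ℝ → ℝ) (hg : Continuous g)
    (h0 : g 0 = 0) : IntegrableOn (fun x => g (u x)) Ω volume := by
  have h1 : Continuous (fun x => g (u x)) := hg.comp hu.1.continuous
  have h2 : HasCompactSupport (fun x => g (u x)) := hu.2.1.comp_left h0
  exact (h1.integrable_of_hasCompactSupport h2).integrableOn

lemma aux_lb {Ω : Set E4} (hb : Bornology.IsBounded Ω) (f : E4 → ℝ) (c : ℝ)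
    (hf : IntegrableOn f Ω volume) (h : ∀ x, c ≤ f x) :
    c * (volume Ω).toReal ≤ ∫ x in Ω, f x := by
  have hfin : volume Ω ≠ ⊤ := hb.measure_lt_top.ne
  have := integral_mono (μ := volume.restrict Ω) (f := fun _ => c) (g := f)
    (integrableOn_const (hs := hfin)) hf h
  rw [setIntegral_const] at this
  simpa [Measure.real, mul_comm] using this

lemma aux_quad (m t θ : ℝ) (hm : 0 < m) : -(θ ^ 2 / (4 * m)) ≤ m / 4 * t ^ 2 + θ / 2 * t := by
  have : m / 4 * t ^ 2 + θ / 2 * t + θ ^ 2 / (4 * m) = (m * t + θ) ^ 2 / (4 * m) := by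
    field_simp; ring
  have h2 : 0 ≤ (m * t + θ) ^ 2 / (4 * m) := by positivity
  linarith

lemma aux_log (lam θ t : ℝ) (hθ : θ < 0) (ht : 0 ≤ t) :
    (θ / 4) * Real.exp (-lam / θ - 1) ≤ -(lam / 4) * t + -(θ / 4) * (t * Real.log t) := by
  rcases ht.eq_or_lt with rfl | ht
  · have := Real.exp_pos (-lam / θ - 1)
    simp
    nlinarith
  · set s := -lam / θ - 1 with hs
    have hl : lam = -θ * (s + 1) := by
      have hne : θ ≠ 0 := hθ.ne
      rw [hs]; field_simp; ring
    have h1 := Real.add_one_le_exp (s - Real.log t)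
    rw [Real.exp_sub, Real.exp_log ht, le_div_iff₀ ht] at h1
    rw [hl]
    nlinarith

lemma pp_int {Ω : Set E4} {u : E4 → ℝ} (hu : TestFun Ω u) :
    IntegrableOn (fun x => pp u x ^ 2) Ω volume ∧ IntegrableOn (fun x => pp u x ^ 4) Ω volume ∧
    IntegrableOn (fun x => pp u x ^ 2 * Real.log (pp u x ^ 2)) Ω volume ∧
    IntegrableOn (fun x => u x ^ 2) Ω volume := by
  refine ⟨aux_int hu (fun t => max t 0 ^ 2) (by fun_prop) (by simp),
    aux_int hu (fun t => max t 0 ^ 4) (by fun_prop) (by simp),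
    aux_int hu (fun t => max t 0 ^ 2 * Real.log (max t 0 ^ 2)) ?_ (by simp),
    aux_int hu (fun t => t ^ 2) (by fun_prop) (by simp)⟩
  exact Real.continuous_mul_log.comp (g := fun t : ℝ => t * Real.log t)
    (f := fun t : ℝ => max t 0 ^ 2) (by fun_prop)

lemma pp_split {Ω : Set E4} {u : E4 → ℝ} (hu : TestFun Ω u) :
    ∫ x in Ω, (pp u x) ^ 2 * (Real.log ((pp u x) ^ 2) - 1) =
      (∫ x in Ω, (pp u x) ^ 2 * Real.log ((pp u x) ^ 2)) - ∫ x in Ω, (pp u x) ^ 2 := by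
  obtain ⟨h1, h2, h3, h4⟩ := pp_int hu
  rw [← integral_sub h3 h1]
  simp only [mul_sub, mul_one]

lemma quad_int {Ω : Set E4} (hb : Bornology.IsBounded Ω) {u : E4 → ℝ} (hu : TestFun Ω u)
    (m θ : ℝ) (hm : 0 < m) :
    -(θ ^ 2 / (4 * m)) * (volume Ω).toReal ≤
      m / 4 * (∫ x in Ω, (pp u x) ^ 4) + θ / 2 * ∫ x in Ω, (pp u x) ^ 2 := by
  obtain ⟨h1, h2, h3, h4⟩ := pp_int hu
  rw [← integral_const_mul, ← integral_const_mul, ← integral_add (h2.const_mul _) (h1.const_mul _)]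
  refine aux_lb hb _ _ ((h2.const_mul _).add (h1.const_mul _)) fun x => ?_
  have := aux_quad m (pp u x ^ 2) θ hm
  calc _ ≤ _ := this
    _ = _ := by ring

lemma log_int {Ω : Set E4} (hb : Bornology.IsBounded Ω) {u : E4 → ℝ} (hu : TestFun Ω u)
    (lam θ : ℝ) (hθ : θ < 0) :
    (θ / 4) * Real.exp (-lam / θ - 1) * (volume Ω).toReal ≤
      -(lam / 4) * (∫ x in Ω, (pp u x) ^ 2) +
        -(θ / 4) * ∫ x in Ω, (pp u x) ^ 2 * Real.log ((pp u x) ^ 2) := by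
  obtain ⟨h1, h2, h3, h4⟩ := pp_int hu
  rw [← integral_const_mul, ← integral_const_mul, ← integral_add (h1.const_mul _) (h3.const_mul _)]
  exact aux_lb hb _ _ ((h1.const_mul _).add (h3.const_mul _)) fun x =>
    aux_log lam θ (pp u x ^ 2) hθ (sq_nonneg _)

lemma poinc {Ω : Set E4} {u : E4 → ℝ} (hu : TestFun Ω u) (c : ℝ) (hc : 0 ≤ c)
    (h : c ≤ lamOne Ω) :
    c * (∫ x in Ω, (pp u x) ^ 2) ≤ ∫ x in Ω, gradSq u x := by
  obtain ⟨h1, h2, h3, h4⟩ := pp_int hu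
  have hG : ∀ w : E4 → ℝ, 0 ≤ ∫ x in Ω, gradSq w x := fun w =>
    integral_nonneg fun x => by unfold gradSq; positivity
  have hN : ∀ w : E4 → ℝ, 0 ≤ ∫ x in Ω, (w x) ^ 2 := fun w =>
    integral_nonneg fun x => by positivity
  have hle : ∫ x in Ω, (pp u x) ^ 2 ≤ ∫ x in Ω, (u x) ^ 2 := by
    refine integral_mono h1 h4 fun x => ?_
    simp only [pp]
    rcases max_cases (u x) 0 with h | h <;> rw [h.1]
    simp; positivity
  refine (mul_le_mul_of_nonneg_left hle hc).trans ?_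
  rcases (hN u).eq_or_lt with h0 | h0
  · rw [← h0]; simpa using hG u
  · rw [← le_div_iff₀ h0]
    refine h.trans (csInf_le ⟨0, ?_⟩ ⟨u, hu, ?_, rfl⟩)
    · rintro r ⟨w, -, -, rfl⟩
      exact div_nonneg (hG w) (hN w)
    · rintro rfl
      simp at h0

/-- Quantitative content of Lemma 5.1: lower bounds on `ℒ(u,v)` for pairs with
`ℒ'(u,v)(u,v) = 0`, in the cases `β > 0`, `−√(μ₁μ₂) < β < 0`, and
`2 min{θ₁,θ₂} ≥ −λ₁(Ω)`; in each case the infimum of `ℒ` over all such pairs is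
finite (bounded below). -/
theorem stmt_15 (Ω : Set E4) (hΩne : Ω.Nonempty) (hΩo : IsOpen Ω)
    (hΩb : Bornology.IsBounded Ω)
    (lam1 lam2 μ₁ μ₂ θ₁ θ₂ β : ℝ) (hμ₁ : 0 < μ₁) (hμ₂ : 0 < μ₂)
    (hθ₁ : θ₁ < 0) (hθ₂ : θ₂ < 0) :
    (∀ u v : E4 → ℝ, TestFun Ω u → TestFun Ω v →
      LLp Ω lam1 μ₁ θ₁ lam2 μ₂ θ₂ β u v = 0 →
      (0 < β →
        LL Ω lam1 μ₁ θ₁ lam2 μ₂ θ₂ β u v ≥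
          -(θ₁ ^ 2 / (4 * μ₁) + θ₂ ^ 2 / (4 * μ₂)) * (volume Ω).toReal) ∧
      (-Real.sqrt (μ₁ * μ₂) < β → β < 0 →
        LL Ω lam1 μ₁ θ₁ lam2 μ₂ θ₂ β u v ≥
          -(θ₁ ^ 2 / (4 * (μ₁ + β * Real.sqrt (μ₁ / μ₂))) +
            θ₂ ^ 2 / (4 * (μ₂ + β * Real.sqrt (μ₂ / μ₁)))) * (volume Ω).toReal) ∧
      (2 * min θ₁ θ₂ ≥ -lamOne Ω →
        LL Ω lam1 μ₁ θ₁ lam2 μ₂ θ₂ β u v ≥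
          ((θ₁ / 4) * Real.exp (-lam1 / θ₁ - 1) +
            (θ₂ / 4) * Real.exp (-lam2 / θ₂ - 1)) * (volume Ω).toReal)) ∧
    (0 < β ∨ (-Real.sqrt (μ₁ * μ₂) < β ∧ β < 0) ∨ 2 * min θ₁ θ₂ ≥ -lamOne Ω →
      BddBelow { r : ℝ | ∃ u v : E4 → ℝ, TestFun Ω u ∧ TestFun Ω v ∧
        LLp Ω lam1 μ₁ θ₁ lam2 μ₂ θ₂ β u v = 0 ∧
        r = LL Ω lam1 μ₁ θ₁ lam2 μ₂ θ₂ β u v }) := by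
  have key : ∀ u v : E4 → ℝ, TestFun Ω u → TestFun Ω v →
      LLp Ω lam1 μ₁ θ₁ lam2 μ₂ θ₂ β u v = 0 →
      (0 < β →
        LL Ω lam1 μ₁ θ₁ lam2 μ₂ θ₂ β u v ≥
          -(θ₁ ^ 2 / (4 * μ₁) + θ₂ ^ 2 / (4 * μ₂)) * (volume Ω).toReal) ∧
      (-Real.sqrt (μ₁ * μ₂) < β → β < 0 →
        LL Ω lam1 μ₁ θ₁ lam2 μ₂ θ₂ β u v ≥
          -(θ₁ ^ 2 / (4 * (μ₁ + β * Real.sqrt (μ₁ / μ₂))) +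
            θ₂ ^ 2 / (4 * (μ₂ + β * Real.sqrt (μ₂ / μ₁)))) * (volume Ω).toReal) ∧
      (2 * min θ₁ θ₂ ≥ -lamOne Ω →
        LL Ω lam1 μ₁ θ₁ lam2 μ₂ θ₂ β u v ≥
          ((θ₁ / 4) * Real.exp (-lam1 / θ₁ - 1) +
            (θ₂ / 4) * Real.exp (-lam2 / θ₂ - 1)) * (volume Ω).toReal) := by
    intro u v hu hv hL
    have e1 := pp_split hu
    have e2 := pp_split hv
    unfold LLp at hL
    unfold LL
    rw [e1, e2]
    refine ⟨fun hβ => ?_, fun hβ1 hβ2 => ?_, fun hl => ?_⟩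
    · have q1 := quad_int hΩb hu μ₁ θ₁ hμ₁
      have q2 := quad_int hΩb hv μ₂ θ₂ hμ₂
      have hC : 0 ≤ β * ∫ x in Ω, (pp u x) ^ 2 * (pp v x) ^ 2 :=
        mul_nonneg hβ.le (integral_nonneg fun x => by positivity)
      linarith
    · set s := Real.sqrt (μ₁ / μ₂) with hs
      set t := Real.sqrt (μ₂ / μ₁) with ht
      have hs0 : 0 < s := Real.sqrt_pos.2 (by positivity)
      have ht0 : 0 < t := Real.sqrt_pos.2 (by positivity)
      have hst : s * t = 1 := by
        rw [hs, ht, ← Real.sqrt_mul (by positivity)]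
        rw [show μ₁ / μ₂ * (μ₂ / μ₁) = 1 by field_simp]
        exact Real.sqrt_one
      have hm1 : s * Real.sqrt (μ₁ * μ₂) = μ₁ := by
        rw [hs, ← Real.sqrt_mul (by positivity),
          show μ₁ / μ₂ * (μ₁ * μ₂) = μ₁ ^ 2 by field_simp]
        exact Real.sqrt_sq hμ₁.le
      have hm2 : t * Real.sqrt (μ₁ * μ₂) = μ₂ := by
        rw [ht, ← Real.sqrt_mul (by positivity),
          show μ₂ / μ₁ * (μ₁ * μ₂) = μ₂ ^ 2 by field_simp]
        exact Real.sqrt_sq hμ₂.le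
      have p1 : 0 < μ₁ + β * s := by nlinarith
      have p2 : 0 < μ₂ + β * t := by nlinarith
      have q1 := quad_int hΩb hu _ θ₁ p1
      have q2 := quad_int hΩb hv _ θ₂ p2
      have hC : ∫ x in Ω, (pp u x) ^ 2 * (pp v x) ^ 2 ≤
          s / 2 * (∫ x in Ω, (pp u x) ^ 4) + t / 2 * ∫ x in Ω, (pp v x) ^ 4 := by
        have iu := (pp_int hu).2.1
        have iv := (pp_int hv).2.1
        rw [← integral_const_mul, ← integral_const_mul,
          ← integral_add (iu.const_mul _) (iv.const_mul _)]
        refine integral_mono_of_nonneg (Filter.Eventually.of_forall fun x => by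
          simp only [Pi.zero_apply]; positivity)
          ((iu.const_mul _).add (iv.const_mul _)) (Filter.Eventually.of_forall fun x => ?_)
        simp only
        set a := pp u x ^ 2 with ha
        set b := pp v x ^ 2 with hb
        have ea : pp u x ^ 4 = a ^ 2 := by rw [ha]; ring
        have eb : pp v x ^ 4 = b ^ 2 := by rw [hb]; ring
        rw [ea, eb]
        have h1 : s / 2 * a ^ 2 + t / 2 * b ^ 2 - a * b = t / 2 * (s * a - b) ^ 2 := by
          linear_combination (-(s * a ^ 2 / 2) + a * b) * hst
        have h2 : 0 ≤ t / 2 * (s * a - b) ^ 2 := by positivity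
        linarith
      have hC2 := mul_le_mul_of_nonpos_left hC hβ2.le
      nlinarith [hC2, q1, q2, hL]
    · have hmin1 := min_le_left θ₁ θ₂
      have hmin2 := min_le_right θ₁ θ₂
      have g1 := poinc hu (-2 * θ₁) (by linarith) (by linarith)
      have g2 := poinc hv (-2 * θ₂) (by linarith) (by linarith)
      have l1 := log_int hΩb hu lam1 θ₁ hθ₁
      have l2 := log_int hΩb hv lam2 θ₂ hθ₂
      linarith
  refine ⟨key, ?_⟩
  rintro (h | ⟨h, h'⟩ | h)
  · refine ⟨-(θ₁ ^ 2 / (4 * μ₁) + θ₂ ^ 2 / (4 * μ₂)) * (volume Ω).toReal, ?_⟩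
    · rintro r ⟨u, v, hu, hv, hL, rfl⟩
      exact (key u v hu hv hL).1 h
  · refine ⟨-(θ₁ ^ 2 / (4 * (μ₁ + β * Real.sqrt (μ₁ / μ₂))) +
      θ₂ ^ 2 / (4 * (μ₂ + β * Real.sqrt (μ₂ / μ₁)))) * (volume Ω).toReal, ?_⟩
    · rintro r ⟨u, v, hu, hv, hL, rfl⟩
      exact (key u v hu hv hL).2.1 h h'
  · refine ⟨((θ₁ / 4) * Real.exp (-lam1 / θ₁ - 1) +
      (θ₂ / 4) * Real.exp (-lam2 / θ₂ - 1)) * (volume Ω).toReal, ?_⟩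
    · rintro r ⟨u, v, hu, hv, hL, rfl⟩
      exact (key u v hu hv hL).2.2 h
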